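/- There is no positive solution of the scalar impulsive equation \dot x(t) = -x(t) with unit downward jumps at the positive integers. Precisely: there is no function x : ℝ → ℝ such that (i) x(t) > 0 for all t ≥ 0, (ii) x is differentiable at every t > 0 with t ∉ ℤ and satisfies x'(t) = -x(t) there, (iii) x is continuous on each interval (k, k+1] for every natural number k (in particular left-continuous at each positive integer), and (iv) at every positive integer k the right-hand limit lim_{s → k⁺} x(s) exists and equals x(k) - 1. -/

import Mathlib

open Filter

/-- There is no positive solution of `ẋ(t) = -x(t)` with unit downward jumps at the
positive integers: no `x : ℝ → ℝ` can satisfy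
(i) `x t > 0` for all `t ≥ 0`,
(ii) `x` has derivative `-x t` at every `t > 0` with `t` not an integer,
(iii) `x` is continuous on each interval `(k, k+1]` for every natural number `k`,
(iv) at every positive integer `k` the right-hand limit of `x` exists and equals `x k - 1`. -/
theorem no_positive_solution_impulsive :
    ¬ ∃ x : ℝ → ℝ,
      (∀ t : ℝ, 0 ≤ t → 0 < x t) ∧
      (∀ t : ℝ, 0 < t → (∀ n : ℤ, (n : ℝ) ≠ t) → HasDerivAt x (-(x t)) t) ∧
      (∀ k : ℕ, ContinuousOn x (Set.Ioc (k : ℝ) ((k : ℝ) + 1))) ∧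
      (∀ k : ℕ, 0 < k →
        Tendsto x (nhdsWithin (k : ℝ) (Set.Ioi (k : ℝ))) (nhds (x (k : ℝ) - 1))) := by
  rintro ⟨x, hpos, hder, hcont, hjump⟩
  have step : ∀ k : ℕ, 0 < k → x ((k : ℝ) + 1) ≤ x (k : ℝ) - 1 := by
    intro k hk
    have hd : ∀ t ∈ Set.Ioo (k : ℝ) ((k : ℝ) + 1), HasDerivAt x (-(x t)) t := by
      intro t ht
      have hk0 : (0 : ℝ) ≤ k := Nat.cast_nonneg k
      refine hder t (lt_of_le_of_lt hk0 ht.1) ?_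
      rintro n rfl
      have h1 : (k : ℤ) < n := by exact_mod_cast ht.1
      have h2 : n < (k : ℤ) + 1 := by exact_mod_cast ht.2
      omega
    have hanti : AntitoneOn x (Set.Ioc (k : ℝ) ((k : ℝ) + 1)) := by
      apply antitoneOn_of_deriv_nonpos (convex_Ioc _ _) (hcont k)
      · intro t ht
        rw [interior_Ioc] at ht
        exact (hd t ht).differentiableAt.differentiableWithinAt
      · intro t ht
        rw [interior_Ioc] at ht
        rw [(hd t ht).deriv]
        have hk0 : (0 : ℝ) ≤ k := Nat.cast_nonneg k
        have := hpos t (hk0.trans ht.1.le)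
        linarith
    refine ge_of_tendsto (hjump k hk) ?_
    filter_upwards [Ioc_mem_nhdsGT (show (k : ℝ) < (k : ℝ) + 1 by linarith)] with s hs
    exact hanti hs ⟨by linarith, le_rfl⟩ hs.2
  have bound : ∀ n : ℕ, x ((n : ℝ) + 1) ≤ x 1 - n := by
    intro n
    induction n with
    | zero => simp
    | succ m ih =>
      have := step (m + 1) (Nat.succ_pos m)
      push_cast at this ⊢
      linarith
  obtain ⟨n, hn⟩ := exists_nat_gt (x 1)
  have h1 := bound n
  have h2 := hpos ((n : ℝ) + 1) (by positivity)
  linarith
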